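/- Let u : ℝ² → ℝ be of class C³, let K, b, S : ℝ → ℝ be differentiable functions, and suppose u,₂₂(x) ≠ 0 for all x ∈ ℝ² and that u satisfies the Monge–Ampère–type equation u,₁₁u,₂₂ − u,₁₂² + K(S(u,₂)) − b(S(u,₂)) u,₂₂ = 0 at every point. Define ρ := u,₂₂, v := −u,₁₂/u,₂₂, s := S(u,₂), and p := −K(s)/ρ + b(s) (all as functions of x = (x₁, x₂)). Then (ρ, v, s) satisfies the one-dimensional Euler equations of an isentropic fluid: ∂₁ρ + ∂₂(ρv) = 0, ∂₁(ρv) + ∂₂(ρv² + p) = 0, and ∂₁s + v ∂₂s = 0, at every point of ℝ². -/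

import Mathlib

/-- The partial derivative of a scalar function on `ℝⁿ` with respect to `xᵢ`. -/
noncomputable def pdi {n : ℕ} (u : (Fin n → ℝ) → ℝ) (i : Fin n) (x : Fin n → ℝ) : ℝ :=
  fderiv ℝ u x (Pi.single i 1)

theorem contDiff_pdi {n : ℕ} {u : (Fin n → ℝ) → ℝ} {m k : ℕ∞} (hu : ContDiff ℝ k u)
    (hmk : m + 1 ≤ k) (i : Fin n) : ContDiff ℝ m (pdi u i) :=
  (hu.fderiv_right (by exact_mod_cast hmk)).clm_apply contDiff_const

theorem pdi_neg {n : ℕ} (f : (Fin n → ℝ) → ℝ) (i : Fin n) (x : Fin n → ℝ) :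
    pdi (fun y => -f y) i x = -pdi f i x := by
  simp [pdi]

theorem pdi_comp {n : ℕ} {g : ℝ → ℝ} {f : (Fin n → ℝ) → ℝ} {x : Fin n → ℝ}
    (hg : DifferentiableAt ℝ g (f x)) (hf : DifferentiableAt ℝ f x) (i : Fin n) :
    pdi (fun y => g (f y)) i x = deriv g (f x) * pdi f i x := by
  have h := (hg.hasDerivAt.comp_hasFDerivAt x hf.hasFDerivAt).fderiv
  simpa [pdi, Function.comp_def] using congrArg (fun L => L (Pi.single i 1)) h

/-- Mixed second partial derivatives of a `C²` function commute. -/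
theorem pdi_pdi_comm {n : ℕ} {u : (Fin n → ℝ) → ℝ} (hu : ContDiff ℝ 2 u) (i j : Fin n) :
    pdi (pdi u i) j = pdi (pdi u j) i := by
  have hd : Differentiable ℝ (fderiv ℝ u) :=
    (hu.fderiv_right (m := 1) (by norm_num)).differentiable (by norm_num)
  have key : ∀ (k l : Fin n) (x : Fin n → ℝ), pdi (pdi u k) l x =
      fderiv ℝ (fderiv ℝ u) x (Pi.single l 1) (Pi.single k 1) := by
    intro k l x
    have h := ((hd x).hasFDerivAt.clm_apply
      (hasFDerivAt_const (Pi.single k (1 : ℝ) : Fin n → ℝ) x)).fderiv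
    refine (congrArg (fun L => L (Pi.single l 1)) h).trans ?_
    simp
  funext x
  rw [key, key]
  exact (hu.contDiffAt.isSymmSndFDerivAt (by simp)).eq _ _

/-- If `u : ℝ² → ℝ` is `C³`, `u,₂₂ ≠ 0`, and `u` satisfies the
Monge–Ampère equation `u,₁₁u,₂₂ − u,₁₂² + K(S(u,₂)) − b(S(u,₂))u,₂₂ = 0` (the Von Kármán
fluid), then `ρ = u,₂₂`, `v = −u,₁₂/u,₂₂`, `s = S(u,₂)`, `p = −K(s)/ρ + b(s)` satisfy the
one-dimensional Euler equations of an isentropic fluid. -/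
theorem stmt_11 (u : (Fin 2 → ℝ) → ℝ) (hu : ContDiff ℝ 3 u)
    (K b S : ℝ → ℝ) (hK : Differentiable ℝ K) (hb : Differentiable ℝ b)
    (hS : Differentiable ℝ S)
    (hne : ∀ x : Fin 2 → ℝ, pdi (pdi u 1) 1 x ≠ 0)
    (hMA : ∀ x : Fin 2 → ℝ,
      pdi (pdi u 0) 0 x * pdi (pdi u 1) 1 x - (pdi (pdi u 0) 1 x) ^ 2 +
        K (S (pdi u 1 x)) - b (S (pdi u 1 x)) * pdi (pdi u 1) 1 x = 0)
    (ρ v s p : (Fin 2 → ℝ) → ℝ)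
    (hρ : ρ = fun x => pdi (pdi u 1) 1 x)
    (hv : v = fun x => -(pdi (pdi u 0) 1 x) / pdi (pdi u 1) 1 x)
    (hs : s = fun x => S (pdi u 1 x))
    (hp : p = fun x => -(K (s x)) / ρ x + b (s x)) :
    ∀ x : Fin 2 → ℝ,
      pdi ρ 0 x + pdi (fun y => ρ y * v y) 1 x = 0 ∧
      pdi (fun y => ρ y * v y) 0 x + pdi (fun y => ρ y * v y ^ 2 + p y) 1 x = 0 ∧
      pdi s 0 x + v x * pdi s 1 x = 0 := by
  have hu2 : ContDiff ℝ 2 u := hu.of_le (by norm_num)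
  have hC : ∀ i, ContDiff ℝ 2 (pdi u i) := fun i =>
    contDiff_pdi (m := 2) (k := 3) hu (by norm_num) i
  have hcomm := pdi_pdi_comm hu2 1 0
  have hmom : (fun y => ρ y * v y) = fun y => -pdi (pdi u 0) 1 y := by
    funext y
    have := hne y
    simp only [hρ, hv]
    field_simp
  have hflux : (fun y => ρ y * v y ^ 2 + p y) = pdi (pdi u 0) 0 := by
    funext y
    have := hne y
    simp only [hp, hρ, hv, hs]
    field_simp
    linear_combination -hMA y
  intro x
  rw [hmom, hflux, pdi_neg, pdi_neg]
  refine ⟨?_, ?_, ?_⟩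
  · have hρ' : ρ = pdi (pdi u 1) 1 := hρ
    rw [hρ', pdi_pdi_comm (hC 1) 1 0, hcomm]
    ring
  · rw [pdi_pdi_comm (hC 0) 1 0]
    ring
  · have hd : DifferentiableAt ℝ (pdi u 1) x := (hC 1).differentiable (by norm_num) x
    have := hne x
    rw [hs, pdi_comp (hS _) hd, pdi_comp (hS _) hd, hcomm, hv]
    field_simp
    ring
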